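/- For every finitely generated non-amenable group Γ and every n ∈ ℕ, there exists a finite symmetric generating multi-set S of Γ such that the expected degree of the free minimal spanning forest of Cay(Γ,S) is at least n. -/

import Mathlib

open MeasureTheory Filter

/-- A multigraph given by oriented edges: each oriented edge `e` has a `tail`, a `head`
and an opposite edge `op e ≠ e`. -/
structure Multigraph where
  V : Type
  E : Type
  tail : E → V
  head : E → V
  op : E → E
  op_op : ∀ e, op (op e) = e
  op_ne : ∀ e, op e ≠ e
  tail_op : ∀ e, tail (op e) = head e
  head_op : ∀ e, head (op e) = tail e

namespace Multigraph

variable (G : Multigraph)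

/-- `n` consecutive oriented edges: the head of each edge is the tail of the next one. -/
def IsWalk (n : ℕ) (c : Fin n → G.E) : Prop :=
  ∀ i : Fin n, ∀ h : (i : ℕ) + 1 < n, G.head (c i) = G.tail (c ⟨(i : ℕ) + 1, h⟩)

/-- A path of length `n` from `x` to `y`. -/
def IsWalkFromTo (n : ℕ) (c : Fin n → G.E) (x y : G.V) : Prop :=
  G.IsWalk n c ∧
    (∀ h : 0 < n, G.tail (c ⟨0, h⟩) = x ∧ G.head (c ⟨n - 1, by omega⟩) = y) ∧
    (n = 0 → x = y)

/-- `c(n,x,y)`: the number of paths of length `n` from `x` to `y`. -/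
noncomputable def pathCount (n : ℕ) (x y : G.V) : ℕ :=
  Nat.card {c : Fin n → G.E // G.IsWalkFromTo n c x y}

/-- Vertex transitivity: any vertex can be mapped to any other by a graph automorphism. -/
def VertexTransitive : Prop :=
  ∀ x y : G.V, ∃ (φV : G.V ≃ G.V) (φE : G.E ≃ G.E),
    (∀ e, G.tail (φE e) = φV (G.tail e)) ∧ (∀ e, G.head (φE e) = φV (G.head e)) ∧
    (∀ e, G.op (φE e) = φE (G.op e)) ∧ φV x = y

/-- Connectivity: any two vertices are joined by a sequence of edges. -/
def Connected : Prop :=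
  ∀ x y : G.V, Relation.ReflTransGen (fun u v => ∃ e, G.tail e = u ∧ G.head e = v) x y

/-- Each vertex has degree `d`, i.e. exactly `d` oriented edges emanate from it. -/
def Degree (d : ℕ) : Prop := ∀ x : G.V, Nat.card {e : G.E // G.tail e = x} = d

/-- The spectral radius `(1/d)·limsup_n c(n)^{1/n}`, where `c(n)` is the number of cycles
of length `n` rooted at the base vertex `x₀`. -/
noncomputable def spectralRadius (d : ℕ) (x₀ : G.V) : ℝ :=
  (1 / (d : ℝ)) * limsup (fun n : ℕ => (G.pathCount n x₀ x₀ : ℝ) ^ ((n : ℝ)⁻¹)) atTop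

/-- Unordered edges: oriented edges modulo the orientation reversal `op`. -/
def UEdge : Type := Quot (fun e f : G.E => f = G.op e)

/-- The unordered edge underlying an oriented edge. -/
def uedge (e : G.E) : G.UEdge := Quot.mk _ e

/-- A simple cycle of length `n ≥ 1` rooted at `x`: a closed path from `x` to `x` in which
no vertex is visited twice and which is not a backtracking pair `(e, op e)`. -/
def IsSimpleCycle (n : ℕ) (c : Fin n → G.E) (x : G.V) : Prop :=
  1 ≤ n ∧ G.IsWalkFromTo n c x x ∧
    Function.Injective (fun i : Fin n => G.tail (c i)) ∧
    ∀ h : n = 2, c ⟨1, by omega⟩ ≠ G.op (c ⟨0, by omega⟩)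

/-- In the labelling `lbl`, the edge `e` is cut: it belongs to some simple cycle on which
its label is maximal. -/
def IsCut (lbl : G.UEdge → ℝ) (e : G.E) : Prop :=
  ∃ (n : ℕ) (x : G.V) (c : Fin n → G.E), G.IsSimpleCycle n c x ∧
    ∃ i : Fin n, (c i = e ∨ c i = G.op e) ∧
      ∀ j : Fin n, lbl (G.uedge (c j)) ≤ lbl (G.uedge (c i))

/-- The edge `e` survives the cutting procedure defining the free minimal spanning
forest. -/
def Survives (lbl : G.UEdge → ℝ) (e : G.E) : Prop := ¬ G.IsCut lbl e

/-- `μ` is the distribution of i.i.d. uniform-`[0,1]` labels on the unordered edges. -/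
def IsIIDUniform (μ : Measure (G.UEdge → ℝ)) : Prop :=
  IsProbabilityMeasure μ ∧
    ∀ (s : Finset G.UEdge) (f : G.UEdge → Set ℝ), (∀ e ∈ s, MeasurableSet (f e)) →
      μ {lbl | ∀ e ∈ s, lbl e ∈ f e} = ∏ e ∈ s, volume (f e ∩ Set.Icc (0 : ℝ) 1)

/-- Number of surviving oriented edges at `x₀` in the labelling `lbl`. -/
noncomputable def survivingDegree (lbl : G.UEdge → ℝ) (x₀ : G.V) : ℕ :=
  Nat.card {e : {e : G.E // G.tail e = x₀} // G.Survives lbl e.1}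

end Multigraph

section Cayley

variable (Γ : Type) [Group Γ]

/-- Følner characterization of amenability for a group. -/
def FolnerAmenable : Prop :=
  ∀ (T : Finset Γ) (ε : ℝ), 0 < ε → ∃ F : Finset Γ, F.Nonempty ∧
    ∀ g ∈ T, letI := Classical.decEq Γ
      (((F.image (fun x => g * x)) \ F).card : ℝ) ≤ ε * F.card

/-- The Cayley graph of a group `Γ` with respect to a finite symmetric generating
multi-set, given by an index type `ι`, a labelling `s : ι → Γ` and an involution
`inv : ι → ι` with `s (inv i) = (s i)⁻¹` (pairing each oriented edge with its opposite). -/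
def mkCayley (ι : Type) (s : ι → Γ) (inv : ι → ι)
    (h1 : ∀ i, inv (inv i) = i) (h2 : ∀ i, s (inv i) = (s i)⁻¹)
    (h3 : ∀ i, inv i = i → s i ≠ 1) : Multigraph where
  V := Γ
  E := Γ × ι
  tail := Prod.fst
  head := fun e => s e.2 * e.1
  op := fun e => (s e.2 * e.1, inv e.2)
  op_op := by rintro ⟨g, i⟩; simp [h1, h2]
  op_ne := by
    rintro ⟨g, i⟩ h
    rw [Prod.mk.injEq] at h
    refine h3 i h.2 ?_
    have hg : s i * g = g := h.1
    have : s i * g = 1 * g := by rw [one_mul]; exact hg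
    exact mul_right_cancel this
  tail_op := fun _ => rfl
  head_op := by rintro ⟨g, i⟩; simp [h2]

/-- The product of the word `w` of length `k` in the letters `s i`. -/
def wordProd (ι : Type) (s : ι → Γ) (k : ℕ) (w : Fin k → ι) : Γ :=
  (List.ofFn fun j => s (w j)).prod

/-- The Cayley graph of `Γ` with respect to the multi-set `S^{[k]}` of words of length `k`
in the multi-set `S = (s i)_{i : ι}` (with a chosen pairing `invk` of opposite words). -/
def wordCayley (ι : Type) (s : ι → Γ) (k : ℕ) (invk : (Fin k → ι) → (Fin k → ι))
    (h1 : ∀ w, invk (invk w) = w)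
    (h2 : ∀ w, wordProd Γ ι s k (invk w) = (wordProd Γ ι s k w)⁻¹)
    (h3 : ∀ w, invk w = w → wordProd Γ ι s k w ≠ 1) : Multigraph :=
  mkCayley Γ (Fin k → ι) (wordProd Γ ι s k) invk h1 h2 h3

end Cayley

open Multigraph MeasureTheory

theorem layer_cake_boundary {Γ : Type} [Group Γ] (S : Finset Γ) {ε : ℝ}
    (hS : ∀ F : Finset Γ, F.Nonempty →
      ε * F.card ≤ ∑ g ∈ S, ∑ x ∈ F, (Set.indicator {y | y ∉ F} 1 (g * x) : ℝ))
    (F : Finset Γ) : ∀ h : Γ → ℝ, (∀ x, 0 ≤ h x) → (∀ x ∉ F, h x = 0) →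
      ε * ∑ x ∈ F, h x ≤ ∑ g ∈ S, ∑ x ∈ F, max (h x - h (g * x)) 0 := by
  classical
  induction F using Finset.strongInduction with
  | H F ih =>
  intro h h0 hF
  rcases F.eq_empty_or_nonempty with rfl | hne
  · simp
  obtain ⟨x₀, hx₀, hmin⟩ := F.exists_min_image h hne
  set h' : Γ → ℝ := fun x => if x ∈ F then h x - h x₀ else 0 with hh'
  have h'x₀ : h' x₀ = 0 := by simp [hh']
  have h'0 : ∀ x, 0 ≤ h' x := fun x => by
    simp only [hh']
    split_ifs with hx
    · linarith [hmin x hx]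
    · rfl
  have key := ih (F.erase x₀) (Finset.erase_ssubset hx₀) h' h'0 fun x hx => by
    by_cases hxF : x ∈ F
    · have : x = x₀ := by
        by_contra hne
        exact hx (Finset.mem_erase.2 ⟨hne, hxF⟩)
      rw [this, h'x₀]
    · simp [hh', hxF]
  have e1 : ∑ x ∈ F.erase x₀, h' x = ∑ x ∈ F, h' x := Finset.sum_erase _ h'x₀
  have e2 : ∀ g, ∑ x ∈ F.erase x₀, max (h' x - h' (g * x)) 0
      = ∑ x ∈ F, max (h' x - h' (g * x)) 0 := fun g =>
    Finset.sum_erase _ (by rw [h'x₀, max_eq_right]; linarith [h'0 (g * x₀)])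
  simp only [e1, e2] at key
  have e3 : ∑ x ∈ F, h x = h x₀ * F.card + ∑ x ∈ F, h' x := by
    rw [mul_comm, ← nsmul_eq_mul, ← Finset.sum_const, ← Finset.sum_add_distrib]
    exact Finset.sum_congr rfl fun x hx => by simp [hh', hx]
  have e4 : ∀ g, ∑ x ∈ F, max (h x - h (g * x)) 0
      = h x₀ * ∑ x ∈ F, (Set.indicator {y | y ∉ F} 1 (g * x) : ℝ)
        + ∑ x ∈ F, max (h' x - h' (g * x)) 0 := fun g => by
    rw [Finset.mul_sum, ← Finset.sum_add_distrib]
    refine Finset.sum_congr rfl fun x hx => ?_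
    by_cases hg : g * x ∈ F
    · simp [hh', hx, hg]
    · simp [hh', hx, hg, hF _ hg, h0 x, hmin x hx]
  simp only [e3, e4, Finset.sum_add_distrib, ← Finset.mul_sum]
  nlinarith [mul_le_mul_of_nonneg_left (hS F hne) (h0 x₀)]

theorem summable_sq_of_finite_support {Γ : Type} {f : Γ → ℝ} (hf : f.support.Finite) :
    Summable fun x => f x ^ 2 :=
  summable_of_hasFiniteSupport (hf.subset fun x hx hfx => hx (by simp [hfx]))

theorem finite_support_mul_left {Γ : Type} [Group Γ] {f : Γ → ℝ} (hf : f.support.Finite) (g : Γ) :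
    (Function.support fun x => f (g * x)).Finite :=
  hf.preimage (f := fun x => g * x) (mul_right_injective g).injOn

theorem tsum_sq_mul_left {Γ : Type} [Group Γ] (f : Γ → ℝ) (g : Γ) :
    ∑' x, f (g * x) ^ 2 = ∑' x, f x ^ 2 :=
  (Equiv.mulLeft g).tsum_eq fun x => f x ^ 2

theorem poincare_of_isoperimetric {Γ : Type} [Group Γ] (S : Finset Γ) {ε : ℝ} (hε : 0 < ε)
    (hS1 : 0 < S.card)
    (hS : ∀ F : Finset Γ, F.Nonempty →
      ε * F.card ≤ ∑ g ∈ S, ∑ x ∈ F, (Set.indicator {y | y ∉ F} 1 (g * x) : ℝ))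
    {f : Γ → ℝ} (hf : f.support.Finite) :
    ε ^ 2 / (4 * S.card) * ∑' x, f x ^ 2 ≤ ∑ g ∈ S, ∑' x, (f (g * x) - f x) ^ 2 := by
  classical
  have hN : ∑' x, f x ^ 2 = ∑ x ∈ hf.toFinset, f x ^ 2 :=
    tsum_eq_sum fun x hx => by simpa using hx
  have h1 := layer_cake_boundary S hS hf.toFinset (fun x => f x ^ 2) (fun x => sq_nonneg _)
    (fun x hx => by simpa using hx)
  rw [← hN] at h1
  set N := ∑' x, f x ^ 2
  have hm : (0 : ℝ) < S.card := by exact_mod_cast hS1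
  set m : ℝ := (S.card : ℝ)
  have h2 : ∀ g ∈ S, ∑ x ∈ hf.toFinset, max (f x ^ 2 - f (g * x) ^ 2) 0
      ≤ (2 * m / ε) * ∑' x, (f (g * x) - f x) ^ 2 + ε / (2 * m) * N := fun g _ => by
    have hgs : Summable fun x => f (g * x) ^ 2 :=
      summable_sq_of_finite_support (finite_support_mul_left hf g)
    have hds : Summable fun x => (f (g * x) - f x) ^ 2 :=
      summable_sq_of_finite_support (f := fun x => f (g * x) - f x)
        (((finite_support_mul_left hf g).union hf).subset (Function.support_sub _ _))
    have a1 : ∑ x ∈ hf.toFinset, (f (g * x) - f x) ^ 2 ≤ ∑' x, (f (g * x) - f x) ^ 2 :=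
      hds.sum_le_tsum _ fun _ _ => sq_nonneg _
    have a2 : ∑ x ∈ hf.toFinset, f (g * x) ^ 2 ≤ N :=
      (hgs.sum_le_tsum _ fun _ _ => sq_nonneg _).trans_eq (tsum_sq_mul_left f g)
    have a3 : ∀ x ∈ hf.toFinset, max (f x ^ 2 - f (g * x) ^ 2) 0
        ≤ (2 * m / ε) * (f (g * x) - f x) ^ 2
          + ε / (2 * m) * (f x ^ 2 / 2 + f (g * x) ^ 2 / 2) := fun x _ => by
      generalize f x = a
      generalize f (g * x) = b
      refine max_le ?_ (by positivity)
      have hc : (2 * m / ε) * (ε / (2 * m)) = 1 := by field_simp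
      have hp : 0 < 2 * m / ε := by positivity
      have hq : 0 < ε / (2 * m) := by positivity
      set p := 2 * m / ε
      set q := ε / (2 * m)
      nlinarith [mul_nonneg hp.le (sq_nonneg ((b - a) + q / 2 * (b + a))),
        mul_nonneg hq.le (sq_nonneg (b - a))]
    refine (Finset.sum_le_sum a3).trans ?_
    rw [Finset.sum_add_distrib, ← Finset.mul_sum, ← Finset.mul_sum, Finset.sum_add_distrib,
      ← Finset.sum_div, ← Finset.sum_div, ← hN]
    gcongr
    linarith
  have h3 := h1.trans (Finset.sum_le_sum h2)
  rw [Finset.sum_add_distrib, ← Finset.mul_sum, Finset.sum_const, nsmul_eq_mul] at h3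
  change _ ≤ _ + m * _ at h3
  set D := ∑ g ∈ S, ∑' x, (f (g * x) - f x) ^ 2
  have e : m * (ε / (2 * m) * N) = ε / 2 * N := by field_simp
  rw [e] at h3
  have h4 : ε / 2 * N ≤ 2 * m / ε * D := by linarith
  calc ε ^ 2 / (4 * m) * N = ε / (2 * m) * (ε / 2 * N) := by field_simp; ring
    _ ≤ ε / (2 * m) * (2 * m / ε * D) := by gcongr
    _ = D := by field_simp

theorem sq_sum_add_sum_sq_sub_le {α : Type} (S : Finset α) (v : α → ℝ) {a : α} (ha : a ∈ S) :
    (∑ i ∈ S, v i) ^ 2 + ∑ i ∈ S, (v i - v a) ^ 2 ≤ S.card * ∑ i ∈ S, v i ^ 2 := by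
  classical
  have h := sq_sum_le_card_mul_sum_sq (s := S.erase a) (f := fun i => v i - v a)
  have e1 : ∑ i ∈ S.erase a, (v i - v a) = ∑ i ∈ S, (v i - v a) := Finset.sum_erase _ (by simp)
  have e2 : ∑ i ∈ S.erase a, (v i - v a) ^ 2 = ∑ i ∈ S, (v i - v a) ^ 2 :=
    Finset.sum_erase _ (by simp)
  rw [e1, e2, Finset.card_erase_of_mem ha, Nat.cast_pred (Finset.card_pos.2 ⟨a, ha⟩)] at h
  have e3 : ∑ i ∈ S, (v i - v a) ^ 2
      = ∑ i ∈ S, v i ^ 2 - 2 * v a * ∑ i ∈ S, v i + S.card * v a ^ 2 := by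
    simp only [sub_sq, Finset.sum_add_distrib, Finset.sum_sub_distrib, Finset.mul_sum,
      Finset.sum_const, nsmul_eq_mul]
    congr 2
    exact Finset.sum_congr rfl fun i _ => by ring
  have e4 : ∑ i ∈ S, (v i - v a) = ∑ i ∈ S, v i - S.card * v a := by
    simp [Finset.sum_sub_distrib]
  rw [e4] at h
  nlinarith

/-- `C` bounds the squared `ℓ²`-operator norm of `f ↦ ∑ i, f (s i * ·)`. -/
def L2Bound {Γ ι : Type} [Group Γ] [Fintype ι] (s : ι → Γ) (C : ℝ) : Prop :=
  ∀ f : Γ → ℝ, f.support.Finite → ∑' x, (∑ i, f (s i * x)) ^ 2 ≤ C * ∑' x, f x ^ 2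

theorem finite_support_sum_mul_left {Γ ι : Type} [Group Γ] [Fintype ι] (s : ι → Γ) {f : Γ → ℝ}
    (hf : f.support.Finite) : (Function.support fun x => ∑ i, f (s i * x)).Finite := by
  refine (Set.finite_iUnion fun i => finite_support_mul_left hf (s i)).subset fun x hx => ?_
  obtain ⟨i, -, hi⟩ := Finset.exists_ne_zero_of_sum_ne_zero hx
  exact Set.mem_iUnion.2 ⟨i, hi⟩

theorem l2Bound_of_isoperimetric {Γ : Type} [Group Γ] (S : Finset Γ) {ε : ℝ} (hε : 0 < ε)
    (hS1 : 1 ∈ S)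
    (hS : ∀ F : Finset Γ, F.Nonempty →
      ε * F.card ≤ ∑ g ∈ S, ∑ x ∈ F, (Set.indicator {y | y ∉ F} 1 (g * x) : ℝ)) :
    L2Bound (fun g : S => (g : Γ)) ((S.card : ℝ) ^ 2 - ε ^ 2 / (4 * S.card)) := by
  intro f hf
  have hP := poincare_of_isoperimetric S hε (Finset.card_pos.2 ⟨1, hS1⟩) hS hf
  have hgs : ∀ g : Γ, Summable fun x => f (g * x) ^ 2 := fun g =>
    summable_sq_of_finite_support (finite_support_mul_left hf g)
  have hds : ∀ g : Γ, Summable fun x => (f (g * x) - f x) ^ 2 := fun g =>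
    summable_sq_of_finite_support (f := fun x => f (g * x) - f x)
      (((finite_support_mul_left hf g).union hf).subset (Function.support_sub _ _))
  have hss : Summable fun x => (∑ g : S, f (g * x)) ^ 2 :=
    summable_sq_of_finite_support (finite_support_sum_mul_left _ hf)
  have hconv : ∀ x, ∑ g : S, f (g * x) = ∑ g ∈ S, f (g * x) := fun x =>
    Finset.sum_coe_sort S fun g => f (g * x)
  have h1 : ∑' x, ((∑ g : S, f (g * x)) ^ 2 + ∑ g ∈ S, (f (g * x) - f x) ^ 2)
      ≤ ∑' x, S.card * ∑ g ∈ S, f (g * x) ^ 2 := by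
    refine Summable.tsum_le_tsum (fun x => ?_) (hss.add (summable_sum fun g _ => hds g))
      ((summable_sum fun g _ => hgs g).mul_left _)
    have := sq_sum_add_sum_sq_sub_le S (fun g => f (g * x)) hS1
    rw [hconv]
    simpa using this
  rw [hss.tsum_add (summable_sum fun g _ => hds g), tsum_mul_left,
    Summable.tsum_finsetSum fun g _ => hgs g, Summable.tsum_finsetSum fun g _ => hds g] at h1
  simp only [tsum_sq_mul_left, Finset.sum_const, nsmul_eq_mul] at h1
  dsimp only
  linarith

theorem L2Bound.mono {Γ ι : Type} [Group Γ] [Fintype ι] {s : ι → Γ} {C C' : ℝ}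
    (h : L2Bound s C) (hC : C ≤ C') : L2Bound s C' := fun f hf =>
  (h f hf).trans (mul_le_mul_of_nonneg_right hC (tsum_nonneg fun _ => sq_nonneg _))

theorem L2Bound.mul {Γ ι κ : Type} [Group Γ] [Fintype ι] [Fintype κ] {s : ι → Γ} {t : κ → Γ}
    {C D : ℝ} (hC : 0 ≤ C) (hs : L2Bound s C) (ht : L2Bound t D) :
    L2Bound (fun p : κ × ι => t p.1 * s p.2) (C * D) := fun f hf => by
  have h1 := hs _ (finite_support_sum_mul_left t hf)
  have h2 := mul_le_mul_of_nonneg_left (ht f hf) hC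
  refine (le_of_eq ?_).trans (h1.trans (h2.trans_eq (mul_assoc _ _ _).symm))
  simp only [Fintype.sum_prod_type_right, mul_assoc]

theorem L2Bound.comp_equiv {Γ ι κ : Type} [Group Γ] [Fintype ι] [Fintype κ] {s : ι → Γ} {C : ℝ}
    (hs : L2Bound s C) (e : κ ≃ ι) : L2Bound (s ∘ e) C := fun f hf => by
  refine (le_of_eq ?_).trans (hs f hf)
  exact tsum_congr fun x => by rw [← e.sum_comp]; rfl

theorem L2Bound.sum {Γ ι : Type} [Group Γ] [Fintype ι] {s t : ι → Γ} {C : ℝ}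
    (hs : L2Bound s C) (ht : L2Bound t C) :
    L2Bound (fun p : ι × Bool => if p.2 then s p.1 else t p.1) (4 * C) := fun f hf => by
  have a1 := summable_sq_of_finite_support (finite_support_sum_mul_left s hf)
  have a2 := summable_sq_of_finite_support (finite_support_sum_mul_left t hf)
  have a3 := summable_sq_of_finite_support (finite_support_sum_mul_left
    (fun p : ι × Bool => if p.2 then s p.1 else t p.1) hf)
  have h := a3.tsum_le_tsum (g := fun x => 2 * (∑ i, f (s i * x)) ^ 2 + 2 * (∑ i, f (t i * x)) ^ 2)
    (fun x => by
      simp only [Fintype.sum_prod_type_right, Fintype.sum_bool, if_true, Bool.false_eq_true,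
        if_false]
      nlinarith [sq_nonneg (∑ i, f (s i * x) - ∑ i, f (t i * x))])
    ((a1.mul_left 2).add (a2.mul_left 2))
  rw [(a1.mul_left 2).tsum_add (a2.mul_left 2), tsum_mul_left, tsum_mul_left] at h
  linarith [hs f hf, ht f hf]

/-- The endpoint of the walk from `x` spelled by the word `w`. -/
def wordEnd {Γ ι : Type} [Group Γ] (s : ι → Γ) {n : ℕ} (w : Fin n → ι) (x : Γ) : Γ :=
  (List.ofFn w).foldl (fun y i => s i * y) x

theorem wordEnd_eq {Γ ι : Type} [Group Γ] (s : ι → Γ) {n : ℕ} (w : Fin n → ι) (v : ℕ → Γ)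
    (hv : ∀ j : Fin n, v (j + 1) = s (w j) * v j) : wordEnd s w (v 0) = v n := by
  induction n generalizing v with
  | zero => simp [wordEnd]
  | succ n ih =>
    have := ih (fun j => w j.succ) (fun j => v (j + 1)) fun j => by simpa using hv j.succ
    have h0 := hv 0
    simp only [Fin.val_zero] at h0
    rw [← this, h0]
    simp [wordEnd, List.ofFn_succ]

theorem L2Bound.card_closed_words {Γ ι : Type} [Group Γ] [Fintype ι] {s : ι → Γ} {D : ℝ}
    (hD : 0 ≤ D) (hs : L2Bound s (D ^ 2)) (n : ℕ) :
    (Nat.card {w : Fin n → ι // wordEnd s w 1 = 1} : ℝ) ≤ D ^ n := by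
  classical
  have key : ∀ n : ℕ, ∀ f : Γ → ℝ, f.support.Finite →
      (Function.support fun x => ∑ w : Fin n → ι, f (wordEnd s w x)).Finite ∧
      ∑' x, (∑ w : Fin n → ι, f (wordEnd s w x)) ^ 2 ≤ (D ^ 2) ^ n * ∑' x, f x ^ 2 := by
    intro n
    induction n with
    | zero => intro f hf; simpa [wordEnd] using hf
    | succ n ih =>
      intro f hf
      have e : ∀ x, ∑ w : Fin (n + 1) → ι, f (wordEnd s w x)
          = ∑ i, ∑ w : Fin n → ι, f (wordEnd s w (s i * x)) := fun x => by
        rw [← (Fin.consEquiv fun _ => ι).sum_comp, Fintype.sum_prod_type]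
        simp [wordEnd, List.ofFn_succ]
      obtain ⟨h1, h2⟩ := ih f hf
      simp only [e]
      refine ⟨finite_support_sum_mul_left s h1, (hs _ h1).trans ?_⟩
      rw [pow_succ' (D ^ 2), mul_assoc]
      exact mul_le_mul_of_nonneg_left h2 (sq_nonneg D)
  have hδ : (Function.support (Pi.single (1 : Γ) (1 : ℝ))).Finite :=
    (Set.finite_singleton 1).subset Pi.support_single_subset
  obtain ⟨h1, h2⟩ := key n _ hδ
  have h3 := (summable_sq_of_finite_support h1).le_tsum 1 fun _ _ => sq_nonneg _
  have e1 : ∑' x, (Pi.single (1 : Γ) (1 : ℝ) : Γ → ℝ) x ^ 2 = 1 := by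
    rw [tsum_eq_single 1 fun x hx => by simp [hx]]
    simp
  have e2 : ∑ w : Fin n → ι, (Pi.single (1 : Γ) (1 : ℝ) : Γ → ℝ) (wordEnd s w 1)
      = Nat.card {w : Fin n → ι // wordEnd s w 1 = 1} := by
    simp [Pi.single_apply, Fintype.card_subtype]
  rw [e1, mul_one] at h2
  rw [e2] at h3
  refine (sq_le_sq₀ (by positivity) (by positivity)).1 ?_
  rw [← pow_mul, mul_comm n, pow_mul]
  exact h3.trans h2

theorem countable_of_closure_eq_top {Γ : Type} [Group Γ] (T : Finset Γ)
    (hT : Subgroup.closure (T : Set Γ) = ⊤) : Countable Γ := by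
  have h : Function.Surjective (FreeGroup.lift fun t : T => (t : Γ)) := by
    rw [← MonoidHom.range_eq_top, FreeGroup.range_lift_eq_closure, ← hT]
    simp
  have h2 : Function.Surjective (FreeGroup.mk : List (T × Bool) → FreeGroup T) :=
    Quot.mk_surjective
  exact (h.comp h2).countable

namespace Multigraph

variable {G : Multigraph}

theorem uedge_op (e : G.E) : G.uedge (G.op e) = G.uedge e :=
  (Quot.sound (r := fun e f : G.E => f = G.op e) rfl).symm

theorem eq_or_eq_op_of_uedge_eq {e f : G.E} (h : G.uedge e = G.uedge f) : f = e ∨ f = G.op e := by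
  let φ : G.UEdge → Set G.E := Quot.lift (fun e => {e, G.op e}) (by
    rintro a _ rfl
    rw [G.op_op, Set.pair_comm])
  have hφ : φ (G.uedge f) = φ (G.uedge e) := by rw [h]
  change ({f, G.op f} : Set G.E) = {e, G.op e} at hφ
  have : f ∈ ({e, G.op e} : Set G.E) := hφ ▸ Set.mem_insert _ _
  simpa using this

/-- Closed walks of length `n + 1` traversing pairwise distinct unordered edges. -/
def IsCircuit (G : Multigraph) (n : ℕ) (c : Fin (n + 1) → G.E) : Prop :=
  (∀ j, G.head (c j) = G.tail (c (j + 1))) ∧ Function.Injective fun j => G.uedge (c j)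

theorem IsSimpleCycle.isCircuit {n : ℕ} {c : Fin (n + 1) → G.E} {x : G.V}
    (h : G.IsSimpleCycle (n + 1) c x) : G.IsCircuit n c := by
  obtain ⟨-, ⟨hw, hend, -⟩, hinj, h2⟩ := h
  have hcyc : ∀ j, G.head (c j) = G.tail (c (j + 1)) := fun j => by
    by_cases hj : (j : ℕ) + 1 < n + 1
    · rw [hw j hj]
      congr 2
      ext
      rw [Fin.val_add_one_of_lt' hj]
    · have hjl : j = Fin.last n := by
        ext
        simp only [Fin.val_last]
        omega
      obtain ⟨ht, hh⟩ := hend (Nat.succ_pos n)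
      subst hjl
      rw [Fin.last_add_one]
      exact hh.trans ht.symm
  refine ⟨hcyc, fun j l hjl => ?_⟩
  rcases eq_or_eq_op_of_uedge_eq hjl with h | h
  · exact hinj (congrArg G.tail h.symm)
  · have a1 : l = j + 1 := hinj (by
      change G.tail (c l) = G.tail (c (j + 1))
      rw [h, G.tail_op, hcyc])
    have a2 : j = l + 1 := hinj (by
      change G.tail (c j) = G.tail (c (l + 1))
      rw [← hcyc, h, G.head_op])
    rcases n with _ | _ | n
    · exact Subsingleton.elim (α := Fin 1) _ _
    · exfalso
      have := h2 rfl
      fin_cases j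
      · simp only [Fin.zero_eta, zero_add] at a1 h
        subst a1
        exact this h
      · simp only [Fin.mk_one, Fin.isValue] at a1 h
        have : l = 0 := a1
        subst this
        apply h2 rfl
        change c 1 = G.op (c 0)
        rw [h, G.op_op]
    · exfalso
      subst a1
      have : (1 + 1 : Fin (n + 1 + 1 + 1)) = 0 := by simpa [add_assoc] using a2
      have := congrArg Fin.val this
      rw [Fin.val_add] at this
      simp [Nat.mod_eq_of_lt (show 2 < n + 1 + 1 + 1 by omega)] at this

theorem IsCircuit.exists_head_eq {n : ℕ} {c : Fin (n + 1) → G.E} (h : G.IsCircuit n c) {e : G.E}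
    {i : Fin (n + 1)} (hi : c i = e ∨ c i = G.op e) :
    ∃ c', G.IsCircuit n c' ∧ c' 0 = e ∧ ∀ j, ∃ k, G.uedge (c' j) = G.uedge (c k) := by
  rcases hi with hi | hi
  · refine ⟨fun j => c (i + j), ⟨fun j => by rw [h.1, add_assoc], fun j k hjk => ?_⟩,
      by simpa using hi, fun j => ⟨_, rfl⟩⟩
    exact add_left_cancel (h.2 hjk)
  · refine ⟨fun j => G.op (c (i - j)), ⟨fun j => ?_, fun j k hjk => ?_⟩,
      by simp [hi, G.op_op], fun j => ⟨_, uedge_op _⟩⟩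
    · rw [G.head_op, G.tail_op, h.1]
      congr 2
      abel
    · simp only [uedge_op] at hjk
      exact sub_right_injective (h.2 hjk)

theorem IsCut.exists_isCircuit {lbl : G.UEdge → ℝ} {e : G.E} (h : G.IsCut lbl e) :
    ∃ n c, G.IsCircuit n c ∧ c 0 = e ∧ ∀ j, lbl (G.uedge (c j)) ≤ lbl (G.uedge e) := by
  obtain ⟨n, x, c, hc, i, hi, hmax⟩ := h
  obtain _ | n := n
  · exact i.elim0
  obtain ⟨c', h1, h2, h3⟩ := hc.isCircuit.exists_head_eq hi
  refine ⟨n, c', h1, h2, fun j => ?_⟩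
  obtain ⟨k, hk⟩ := h3 j
  have hie : G.uedge (c i) = G.uedge e := by
    rcases hi with hi | hi <;> rw [hi]
    exact uedge_op e
  rw [hk, ← hie]
  exact hmax k

theorem measurableSet_survives [Countable G.V] [Countable G.E] (e : G.E) :
    MeasurableSet {lbl | G.Survives lbl e} := by
  refine (measurableSet_setOfPred.2 ?_).compl
  refine .exists fun n => .exists fun x => .exists fun c => measurable_const.and ?_
  refine .exists fun i => measurable_const.and (.forall fun j => measurableSet_setOfPred.1 ?_)
  exact measurableSet_le (measurable_pi_apply _) (measurable_pi_apply _)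

theorem IsIIDUniform.measure_forall_le {μ : Measure (G.UEdge → ℝ)} (hμ : G.IsIIDUniform μ)
    {p : ℝ} (hp1 : p ≤ 1) (s : Finset G.UEdge) :
    μ {lbl | ∀ e ∈ s, lbl e ≤ p} = ENNReal.ofReal p ^ s.card := by
  have h := hμ.2 s (fun _ => Set.Iic p) fun _ _ => measurableSet_Iic
  have e : Set.Iic p ∩ Set.Icc (0 : ℝ) 1 = Set.Icc 0 p := by
    ext x
    simp only [Set.mem_inter_iff, Set.mem_Iic, Set.mem_Icc]
    constructor <;> intro h <;> refine ⟨?_, ?_⟩ <;> grind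
  simpa [e] using h

theorem IsIIDUniform.measure_circuit {μ : Measure (G.UEdge → ℝ)} (hμ : G.IsIIDUniform μ)
    {p : ℝ} (hp1 : p ≤ 1) {n : ℕ} {c : Fin (n + 1) → G.E} (hc : G.IsCircuit n c) :
    μ {lbl | ∀ j, lbl (G.uedge (c j)) ≤ p} = ENNReal.ofReal p ^ (n + 1) := by
  classical
  have h := hμ.measure_forall_le hp1 (Finset.univ.image fun j => G.uedge (c j))
  rw [Finset.card_image_of_injective _ hc.2] at h
  simpa using h

theorem IsIIDUniform.measure_low_and_cut_le [Countable G.E] {μ : Measure (G.UEdge → ℝ)}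
    (hμ : G.IsIIDUniform μ) {p : ℝ} (hp1 : p ≤ 1) (e : G.E) :
    μ {lbl | lbl (G.uedge e) ≤ p ∧ G.IsCut lbl e} ≤
      ∑' n : ℕ, ∑' _ : {c : Fin (n + 1) → G.E // G.IsCircuit n c ∧ c 0 = e},
        ENNReal.ofReal p ^ (n + 1) := by
  have hsub : {lbl | lbl (G.uedge e) ≤ p ∧ G.IsCut lbl e} ⊆
      ⋃ n : ℕ, ⋃ c : {c : Fin (n + 1) → G.E // G.IsCircuit n c ∧ c 0 = e},
        {lbl | ∀ j, lbl (G.uedge (c.1 j)) ≤ p} := by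
    rintro lbl ⟨hle, hcut⟩
    obtain ⟨n, c, h1, h2, h3⟩ := hcut.exists_isCircuit
    exact Set.mem_iUnion.2 ⟨n, Set.mem_iUnion.2 ⟨⟨c, h1, h2⟩, fun j => (h3 j).trans hle⟩⟩
  refine (measure_mono hsub).trans ((measure_iUnion_le _).trans (ENNReal.tsum_le_tsum fun n => ?_))
  refine (measure_iUnion_le _).trans (ENNReal.tsum_le_tsum fun c => ?_)
  exact (hμ.measure_circuit hp1 c.2.1).le

theorem survivingDegree_eq_sum {ι : Type} [Fintype ι] {x₀ : G.V}
    (edge : ι ≃ {e : G.E // G.tail e = x₀}) (lbl : G.UEdge → ℝ) :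
    (G.survivingDegree lbl x₀ : ℝ) = ∑ i, {l | G.Survives l (edge i)}.indicator 1 lbl := by
  classical
  have e : {i : ι // G.Survives lbl (edge i)}
      ≃ {e : {e : G.E // G.tail e = x₀} // G.Survives lbl e.1} :=
    edge.subtypeEquiv fun _ => Iff.rfl
  rw [survivingDegree, ← Nat.card_congr e, Nat.card_eq_fintype_card, Fintype.card_subtype]
  simp [Set.indicator_apply]

theorem IsIIDUniform.expected_survivingDegree_ge [Countable G.V] [Countable G.E] {ι : Type}
    [Fintype ι] {μ : Measure (G.UEdge → ℝ)} (hμ : G.IsIIDUniform μ) {p : ℝ} (hp0 : 0 ≤ p)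
    (hp1 : p ≤ 1) {x₀ : G.V} (edge : ι ≃ {e : G.E // G.tail e = x₀})
    (hcirc : ∑ i, ∑' n : ℕ, ∑' _ : {c : Fin (n + 1) → G.E // G.IsCircuit n c ∧ c 0 = edge i},
      ENNReal.ofReal p ^ (n + 1) ≤ 1) :
    Fintype.card ι * p - 1 ≤ ∫ lbl, (G.survivingDegree lbl x₀ : ℝ) ∂μ := by
  have := hμ.1
  have hm : ∀ i, MeasurableSet {l | G.Survives l (edge i)} := fun i => measurableSet_survives _
  have hexp : ∫ lbl, (G.survivingDegree lbl x₀ : ℝ) ∂μ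
      = ∑ i, μ.real {l | G.Survives l (edge i)} := by
    simp only [survivingDegree_eq_sum edge]
    refine (integral_finsetSum _ fun i _ => (integrable_const (1 : ℝ)).indicator (hm i)).trans ?_
    exact Finset.sum_congr rfl fun i _ => integral_indicator_one (hm i)
  rw [hexp]
  have hcut : ∑ i, μ.real {l | l (G.uedge (edge i)) ≤ p ∧ G.IsCut l (edge i)} ≤ 1 := by
    have h := (Finset.sum_le_sum fun i (_ : i ∈ Finset.univ) =>
      hμ.measure_low_and_cut_le hp1 (edge i : G.E)).trans hcirc
    have h' := ENNReal.toReal_mono ENNReal.one_ne_top h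
    rwa [ENNReal.toReal_sum fun i _ => measure_ne_top _ _, ENNReal.toReal_one] at h'
  have hlow : ∀ i, p ≤ μ.real {l | G.Survives l (edge i)}
      + μ.real {l | l (G.uedge (edge i)) ≤ p ∧ G.IsCut l (edge i)} := fun i => by
    have h := hμ.measure_forall_le hp1 {G.uedge (edge i)}
    simp only [Finset.mem_singleton, forall_eq, Finset.card_singleton, pow_one] at h
    have h' : μ.real {l | l (G.uedge (edge i)) ≤ p} = p := by
      rw [measureReal_def, h, ENNReal.toReal_ofReal hp0]
    refine h'.symm.le.trans ((measureReal_mono fun l hl => ?_).trans (measureReal_union_le _ _))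
    by_cases hc : G.IsCut l (edge i)
    · exact Or.inr ⟨hl, hc⟩
    · exact Or.inl hc
  have hsum := Finset.sum_le_sum fun i (_ : i ∈ Finset.univ) => hlow i
  rw [Finset.sum_add_distrib, Finset.sum_const, nsmul_eq_mul, Finset.card_univ] at hsum
  linarith

end Multigraph

section CayleyCircuits

variable {Γ ι : Type} [Group Γ] {s : ι → Γ} {inv : ι → ι}
  {h1 : ∀ i, inv (inv i) = i} {h2 : ∀ i, s (inv i) = (s i)⁻¹} {h3 : ∀ i, inv i = i → s i ≠ 1}

theorem mkCayley_circuit_step {n : ℕ} {c : Fin (n + 1) → Γ × ι}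
    (hc : (mkCayley Γ ι s inv h1 h2 h3).IsCircuit n c) (j : ℕ) :
    (c (Fin.ofNat (n + 1) (j + 1))).1
      = s (c (Fin.ofNat (n + 1) j)).2 * (c (Fin.ofNat (n + 1) j)).1 := by
  have e : Fin.ofNat (n + 1) (j + 1) = Fin.ofNat (n + 1) j + 1 := by
    ext
    simp [Fin.val_add]
  rw [e]
  exact (hc.1 (Fin.ofNat (n + 1) j)).symm

theorem wordEnd_mkCayley_circuit {n : ℕ} {c : Fin (n + 1) → Γ × ι}
    (hc : (mkCayley Γ ι s inv h1 h2 h3).IsCircuit n c) (h0 : (c 0).1 = 1) :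
    wordEnd s (fun j => (c j).2) 1 = 1 := by
  have h := wordEnd_eq s (fun j => (c j).2) (fun j => (c (Fin.ofNat (n + 1) j)).1)
    fun j => by simpa using mkCayley_circuit_step hc j
  have e0 : Fin.ofNat (n + 1) 0 = 0 := rfl
  have e1 : Fin.ofNat (n + 1) (n + 1) = 0 := by ext; simp
  simpa only [e0, e1, h0] using h

theorem mkCayley_circuit_ext {n : ℕ} {c c' : Fin (n + 1) → Γ × ι}
    (hc : (mkCayley Γ ι s inv h1 h2 h3).IsCircuit n c)
    (hc' : (mkCayley Γ ι s inv h1 h2 h3).IsCircuit n c') (h0 : (c 0).1 = (c' 0).1)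
    (hw : ∀ j, (c j).2 = (c' j).2) : c = c' := by
  have key : ∀ j : ℕ, (c (Fin.ofNat (n + 1) j)).1 = (c' (Fin.ofNat (n + 1) j)).1 := by
    intro j
    induction j with
    | zero => exact h0
    | succ j ih => rw [mkCayley_circuit_step hc, mkCayley_circuit_step hc', ih, hw]
  funext j
  exact Prod.ext (by simpa using key j) (hw j)

theorem sum_tsum_circuits_le [Fintype ι] {D p : ℝ} (hD : 0 ≤ D) (hs : L2Bound s (D ^ 2))
    (hp : 0 ≤ p) (hDp : D * p = 1 / 2) :
    ∑ i, ∑' n : ℕ, ∑' _ : {c : Fin (n + 1) → Γ × ι //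
        (mkCayley Γ ι s inv h1 h2 h3).IsCircuit n c ∧ c 0 = (1, i)},
      ENNReal.ofReal p ^ (n + 1) ≤ 1 := by
  classical
  rw [← tsum_fintype (L := .unconditional _), ENNReal.tsum_comm]
  calc _ ≤ ∑' n : ℕ, ENNReal.ofReal ((1 / 2) ^ (n + 1)) := ENNReal.tsum_le_tsum fun n => ?_
    _ = 1 := by
      rw [← ENNReal.ofReal_tsum_of_nonneg (fun n => by positivity)
        ((summable_nat_add_iff 1).2 summable_geometric_two)]
      simp only [pow_succ, tsum_mul_right, tsum_geometric_two]
      norm_num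
  refine (ENNReal.tsum_sigma' fun _ : (Σ i, {c : Fin (n + 1) → Γ × ι //
    (mkCayley Γ ι s inv h1 h2 h3).IsCircuit n c ∧ c 0 = (1, i)}) =>
      ENNReal.ofReal p ^ (n + 1)).symm.le.trans ?_
  have hinj : Function.Injective (fun x : (Σ i, {c : Fin (n + 1) → Γ × ι //
      (mkCayley Γ ι s inv h1 h2 h3).IsCircuit n c ∧ c 0 = (1, i)}) =>
      (⟨fun j => (x.2.1 j).2, wordEnd_mkCayley_circuit x.2.2.1 (by rw [x.2.2.2])⟩ :
        {w : Fin (n + 1) → ι // wordEnd s w 1 = 1})) := by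
    rintro ⟨i, c, hc, hc0⟩ ⟨i', c', hc', hc0'⟩ h
    have h' : ∀ j, (c j).2 = (c' j).2 := congrFun (congrArg Subtype.val h)
    obtain rfl := mkCayley_circuit_ext hc hc' (by rw [hc0, hc0']) h'
    obtain rfl : i = i' := by simpa using hc0.symm.trans hc0'
    rfl
  refine (ENNReal.tsum_comp_le_tsum_of_injective hinj
    fun _ => ENNReal.ofReal p ^ (n + 1)).trans ?_
  rw [tsum_fintype, Finset.sum_const, nsmul_eq_mul, Finset.card_univ, ← ENNReal.ofReal_pow hp,
    ← ENNReal.ofReal_natCast, ← ENNReal.ofReal_mul (by positivity)]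
  refine ENNReal.ofReal_le_ofReal ?_
  rw [← hDp, mul_pow, ← Nat.card_eq_fintype_card]
  exact mul_le_mul_of_nonneg_right (hs.card_closed_words hD (n + 1)) (by positivity)

/-- The oriented edges of a Cayley graph emanating from the identity. -/
def mkCayleyEdgesAtOne (h1 : ∀ i, inv (inv i) = i) (h2 : ∀ i, s (inv i) = (s i)⁻¹)
    (h3 : ∀ i, inv i = i → s i ≠ 1) :
    ι ≃ {e : (mkCayley Γ ι s inv h1 h2 h3).E //
      (mkCayley Γ ι s inv h1 h2 h3).tail e = (1 : Γ)} where
  toFun i := ⟨((1, i) : Γ × ι), rfl⟩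
  invFun e := e.1.2
  left_inv _ := rfl
  right_inv := by
    rintro ⟨⟨g, i⟩, hg⟩
    obtain rfl : g = 1 := hg
    rfl

theorem expected_survivingDegree_ge [Countable Γ] [Fintype ι] {D : ℝ} (hD : 1 / 2 ≤ D)
    (hs : L2Bound s (D ^ 2)) {μ : Measure ((mkCayley Γ ι s inv h1 h2 h3).UEdge → ℝ)}
    (hμ : (mkCayley Γ ι s inv h1 h2 h3).IsIIDUniform μ) :
    Fintype.card ι / (2 * D) - 1
      ≤ ∫ lbl, ((mkCayley Γ ι s inv h1 h2 h3).survivingDegree lbl (1 : Γ) : ℝ) ∂μ := by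
  have hV : Countable (mkCayley Γ ι s inv h1 h2 h3).V := ‹Countable Γ›
  have hE : Countable (mkCayley Γ ι s inv h1 h2 h3).E := inferInstanceAs (Countable (Γ × ι))
  have hD0 : 0 < D := by linarith
  have h := hμ.expected_survivingDegree_ge (p := 1 / (2 * D)) (by positivity)
    (by rw [div_le_one (by positivity)]; linarith) (mkCayleyEdgesAtOne h1 h2 h3)
    (sum_tsum_circuits_le hD0.le hs (by positivity) (by field_simp))
  rwa [mul_one_div] at h

end CayleyCircuits

theorem exists_power_family {Γ : Type} [Group Γ] (S : Finset Γ) (hS1 : 1 ∈ S)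
    (hSinv : ∀ g ∈ S, g⁻¹ ∈ S) {C : ℝ} (hC : 0 ≤ C)
    (hS : L2Bound (fun g : S => (g : Γ)) C) (k : ℕ) :
    ∃ (κ : Type) (_ : Fintype κ) (s : κ → Γ), Fintype.card κ = S.card ^ (k + 1) ∧
      (S : Set Γ) ⊆ Set.range s ∧ L2Bound s (C ^ (k + 1)) ∧
      L2Bound (fun i => (s i)⁻¹) (C ^ (k + 1)) := by
  have hS' : L2Bound (fun g : S => (g : Γ)⁻¹) C :=
    hS.comp_equiv (κ := S)
      { toFun := fun g => ⟨(g : Γ)⁻¹, hSinv _ g.2⟩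
        invFun := fun g => ⟨(g : Γ)⁻¹, hSinv _ g.2⟩
        left_inv := fun g => by simp
        right_inv := fun g => by simp }
  induction k with
  | zero => exact ⟨S, inferInstance, fun g => g, by simp, by simp, by simpa using hS,
      by simpa using hS'⟩
  | succ k ih =>
    obtain ⟨κ, _, s, hcard, hrange, hs, hs'⟩ := ih
    refine ⟨κ × S, inferInstance, fun p => s p.1 * p.2, by simp [hcard, pow_succ], fun g hg => ?_,
      ?_, ?_⟩
    · obtain ⟨i, hi⟩ := hrange hg
      exact ⟨(i, ⟨1, hS1⟩), by simp [hi]⟩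
    · rw [pow_succ']
      exact hS.mul hC hs
    · rw [pow_succ]
      have h := (hs'.mul (by positivity) hS').comp_equiv (Equiv.prodComm κ S)
      simpa [Function.comp_def] using h

theorem exists_isoperimetric_of_not_folnerAmenable {Γ : Type} [Group Γ] (T : Finset Γ)
    (hΓ : ¬ FolnerAmenable Γ) :
    ∃ (S : Finset Γ) (ε : ℝ), T ⊆ S ∧ 1 ∈ S ∧ (∀ g ∈ S, g⁻¹ ∈ S) ∧ 0 < ε ∧
      ∀ F : Finset Γ, F.Nonempty →
        ε * F.card ≤ ∑ g ∈ S, ∑ x ∈ F, (Set.indicator {y | y ∉ F} 1 (g * x) : ℝ) := by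
  classical
  simp only [FolnerAmenable] at hΓ
  push Not at hΓ
  obtain ⟨T₀, ε, hε, h⟩ := hΓ
  let U := insert 1 (T ∪ T₀)
  refine ⟨U ∪ U.image (·⁻¹), ε, ?_, ?_, ?_, hε, fun F hF => ?_⟩
  · exact fun g hg => by simp [U, hg]
  · simp [U]
  · intro g hg
    simp only [Finset.mem_union, Finset.mem_image] at hg ⊢
    rcases hg with hg | ⟨x, hx, rfl⟩
    · exact Or.inr ⟨g, hg, rfl⟩
    · exact Or.inl (by simpa using hx)
  · obtain ⟨g, hg, hlt⟩ := h F hF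
    have e : ((F.image (fun x => g * x) \ F).card : ℝ)
        = ∑ x ∈ F, (Set.indicator {y | y ∉ F} 1 (g * x) : ℝ) := by
      have : F.image (fun x => g * x) \ F = (F.filter fun x => g * x ∉ F).image (g * ·) := by
        ext y
        simp only [Finset.mem_sdiff, Finset.mem_image, Finset.mem_filter]
        grind
      rw [this, Finset.card_image_of_injective _ (mul_right_injective g)]
      simp [Set.indicator_apply, Finset.card_filter]
    have hgS : g ∈ U ∪ U.image (·⁻¹) := by simp [U, hg]
    have hle := Finset.single_le_sum
      (f := fun g => ∑ x ∈ F, (Set.indicator {y | y ∉ F} 1 (g * x) : ℝ))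
      (fun g _ => Finset.sum_nonneg fun x _ => Set.indicator_nonneg (by simp) _) hgS
    rw [← e] at hle
    refine (le_of_lt ?_).trans hle
    convert hlt

/-- For every finitely generated non-amenable group `Γ` and every `n ∈ ℕ`,
there exists a finite symmetric generating multi-set `S` of `Γ` (an index type `ι`,
labelling `s : ι → Γ` and pairing involution `inv`) such that the expected degree of the
free minimal spanning forest of `Cay(Γ,S)` is at least `n`. -/
theorem exists_generating_multiset_fmsf_degree_ge (Γ : Type) [Group Γ]
    (T : Finset Γ) (hT : Subgroup.closure (T : Set Γ) = ⊤)
    (hΓ : ¬ FolnerAmenable Γ) (n : ℕ) :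
    ∃ (ι : Type) (_ : Fintype ι) (s : ι → Γ) (inv : ι → ι)
      (h1 : ∀ i, inv (inv i) = i) (h2 : ∀ i, s (inv i) = (s i)⁻¹)
      (h3 : ∀ i, inv i = i → s i ≠ 1),
      Subgroup.closure (Set.range s) = ⊤ ∧
      ∀ (μ : Measure ((mkCayley Γ ι s inv h1 h2 h3).UEdge → ℝ)),
        (mkCayley Γ ι s inv h1 h2 h3).IsIIDUniform μ →
        ∀ δ : ℝ,
          δ = ∫ lbl, ((mkCayley Γ ι s inv h1 h2 h3).survivingDegree lbl (1 : Γ) : ℝ) ∂μ →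
          (n : ℝ) ≤ δ := by
  have := countable_of_closure_eq_top T hT
  obtain ⟨S, ε, hTS, hS1, hSinv, hε, hiso⟩ := exists_isoperimetric_of_not_folnerAmenable T hΓ
  have hcard : 1 < S.card := by
    by_contra! hle
    obtain rfl : S = {1} := Finset.eq_singleton_iff_unique_mem.2
      ⟨hS1, fun x hx => Finset.card_le_one.1 hle x hx 1 hS1⟩
    have h := hiso {1} (Finset.singleton_nonempty 1)
    simp at h
    linarith
  have hm : (1 : ℝ) < S.card := by exact_mod_cast hcard
  obtain ⟨r, hr1, hrm, hr⟩ : ∃ r : ℝ, 1 ≤ r ∧ r < S.card ∧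
      (S.card : ℝ) ^ 2 - ε ^ 2 / (4 * S.card) ≤ r ^ 2 := by
    refine ⟨max 1 √((S.card : ℝ) ^ 2 - ε ^ 2 / (4 * S.card)), le_max_left _ _,
      max_lt hm ?_, ?_⟩
    · rw [Real.sqrt_lt' (by linarith)]
      have : 0 < ε ^ 2 / (4 * S.card) := by positivity
      linarith
    · exact (Real.sqrt_le_left (by positivity)).1 (le_max_right _ _)
  have hbound := (l2Bound_of_isoperimetric S hε hS1 hiso).mono hr
  obtain ⟨k, hk⟩ := pow_unbounded_of_one_lt (2 * ((n : ℝ) + 1))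
    ((one_lt_div (by linarith)).2 hrm : 1 < (S.card : ℝ) / r)
  obtain ⟨κ, _, t, hκ, hrange, ht, ht'⟩ :=
    exists_power_family S hS1 hSinv (sq_nonneg r) hbound k
  refine ⟨κ × Bool, inferInstance, fun p => if p.2 then t p.1 else (t p.1)⁻¹,
    fun p => (p.1, !p.2), by simp, ?_, ?_, ?_, ?_⟩
  · rintro ⟨i, _ | _⟩ <;> simp
  · rintro ⟨i, b⟩ h
    simp at h
  · rw [eq_top_iff, ← hT]
    refine Subgroup.closure_mono fun g hg => ?_
    obtain ⟨i, hi⟩ := hrange (hTS hg)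
    exact ⟨(i, true), by simpa using hi⟩
  · rintro μ hμ δ rfl
    have hr1k : 1 ≤ r ^ (k + 1) := one_le_pow₀ hr1
    refine le_trans ?_ (expected_survivingDegree_ge (D := 2 * r ^ (k + 1)) (by linarith) ?_ hμ)
    · rw [Fintype.card_prod, hκ, Fintype.card_bool]
      have hk' : 2 * ((n : ℝ) + 1) ≤ (S.card / r) ^ (k + 1) :=
        hk.le.trans (pow_le_pow_right₀ ((one_lt_div (by linarith)).2 hrm).le (Nat.le_succ k))
      rw [div_pow] at hk'
      have e : ((S.card ^ (k + 1) * 2 : ℕ) : ℝ) / (2 * (2 * r ^ (k + 1)))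
          = S.card ^ (k + 1) / r ^ (k + 1) / 2 := by
        push_cast
        field_simp
      rw [e]
      linarith
    · have e : (2 * r ^ (k + 1)) ^ 2 = 4 * (r ^ 2) ^ (k + 1) := by ring
      rw [e]
      exact ht.sum ht'
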